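/- Let q be a positive rational number such that t_j := q/r_j is a nonzero integer for every j ∈ {1, …, s}. For i = 1, …, s−1 write w_{i,s} = 0 and let w'_i be the vector of length |t_1| + … + |t_s| whose first |t_1| entries all equal r_1·w_{i,1}, whose next |t_2| entries all equal r_2·w_{i,2}, and so on, with the last |t_s| entries all equal to r_s·w_{i,s}. Then the minimum of ||R'|| over all left inverses R' of R exists and equals (max_{1≤i≤s−1} |w'_i|_C)/q. -/

import Mathlib

/-- The nondecreasing rearrangement of a tuple. -/
noncomputable def sortedVec {n : ℕ} (x : Fin n → ℝ) : Fin n → ℝ := x ∘ Tuple.sort x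

/-- The center of a tuple `x`: its lower median, i.e. the value `y_l` with
`l = ⌊(n+1)/2⌋` (1-indexed) in the nondecreasing rearrangement `y_1 ≤ … ≤ y_n` of `x`. -/
noncomputable def center {n : ℕ} (x : Fin n → ℝ) : ℝ :=
  if h : 0 < n then
    sortedVec x ⟨(n - 1) / 2, lt_of_le_of_lt (Nat.div_le_self _ _) (Nat.sub_lt h one_pos)⟩
  else 0

/-- The central norm `|x|_C = ∑_{i=1}^n |y_l - y_i|`. -/
noncomputable def centralNorm {n : ℕ} (x : Fin n → ℝ) : ℝ :=
  ∑ i, |center x - sortedVec x i|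

/-- Row norm `‖A‖ = max_i ∑_j |a_{ij}|` of a real matrix. -/
noncomputable def rowNorm {m n : ℕ} (A : Matrix (Fin m) (Fin n) ℝ) : ℝ :=
  ⨆ i, ∑ j, |A i j|

/-- `N(M)`: the infimum (in fact minimum) of the row norms of left inverses of `M`. -/
noncomputable def Nnorm {m n : ℕ} (M : Matrix (Fin m) (Fin n) ℝ) : ℝ :=
  sInf (rowNorm '' {M' : Matrix (Fin n) (Fin m) ℝ | M' * M = 1})

/-- Centralization of a row vector: subtract the center from each entry. -/
noncomputable def centralize {n : ℕ} (x : Fin n → ℝ) : Fin n → ℝ :=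
  fun j => x j - center x

/-- Row-wise centralization of a matrix. -/
noncomputable def matCentralize {m n : ℕ} (B : Matrix (Fin m) (Fin n) ℝ) :
    Matrix (Fin m) (Fin n) ℝ :=
  Matrix.of fun i => centralize (B i)

/-- Central norm of a tuple indexed by an arbitrary finite type (via any enumeration;
the central norm is invariant under permutations of the entries). -/
noncomputable def centralNorm' {α : Type*} [Fintype α] (x : α → ℝ) : ℝ :=
  centralNorm (x ∘ (Fintype.equivFin α).symm)

lemma sortedVec_mono {n : ℕ} (x : Fin n → ℝ) : Monotone (sortedVec x) := Tuple.monotone_sort x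

lemma sum_abs_sorted {n : ℕ} (x : Fin n → ℝ) (u : ℝ) :
    ∑ i, |u - sortedVec x i| = ∑ i, |x i - u| := by
  rw [← Equiv.sum_comp (Tuple.sort x) (fun i => |x i - u|)]
  exact Finset.sum_congr rfl fun i _ => abs_sub_comm _ _

lemma centralNorm_eq {n : ℕ} (x : Fin n → ℝ) : centralNorm x = ∑ i, |x i - center x| :=
  sum_abs_sorted x _

lemma two_sum_rev {n : ℕ} (f : Fin n → ℝ) : 2 * ∑ i, f i = ∑ i, (f i + f i.rev) := by
  rw [Finset.sum_add_distrib, two_mul]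
  congr 1
  exact (Equiv.sum_comp Fin.revPerm f).symm

lemma centralNorm_le {n : ℕ} (x : Fin n → ℝ) (u : ℝ) : centralNorm x ≤ ∑ i, |x i - u| := by
  rw [← sum_abs_sorted]
  suffices h : 2 * centralNorm x ≤ 2 * ∑ i, |u - sortedVec x i| by linarith
  unfold centralNorm
  rw [two_sum_rev, two_sum_rev]
  refine Finset.sum_le_sum fun i _ => ?_
  have hn : 0 < n := i.pos
  have key : ∀ a b : Fin n, a.val ≤ (n-1)/2 → (n-1)/2 ≤ b.val →
      |center x - sortedVec x a| + |center x - sortedVec x b| ≤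
      |u - sortedVec x a| + |u - sortedVec x b| := by
    intro a b ha hb
    have h1 : sortedVec x a ≤ center x := by
      unfold center; rw [dif_pos hn]; exact sortedVec_mono x ha
    have h2 : center x ≤ sortedVec x b := by
      unfold center; rw [dif_pos hn]; exact sortedVec_mono x hb
    rw [abs_of_nonneg (by linarith), abs_of_nonpos (by linarith)]
    linarith [le_abs_self (u - sortedVec x a), neg_abs_le (u - sortedVec x b)]
  have hi := i.isLt
  have hrev : i.rev.val = n - (i.val + 1) := Fin.val_rev i
  rcases le_total i.val ((n-1)/2) with h | h
  · by_cases h' : (n-1)/2 ≤ i.rev.val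
    · exact key _ _ h h'
    · omega
  · by_cases h' : i.rev.val ≤ (n-1)/2
    · have := key _ _ h' h
      linarith
    · exact key _ _ (by omega) (by omega)

lemma centralNorm'_le {α : Type*} [Fintype α] (x : α → ℝ) (u : ℝ) :
    centralNorm' x ≤ ∑ i, |x i - u| := by
  rw [← Equiv.sum_comp (Fintype.equivFin α).symm]
  exact centralNorm_le _ u

lemma centralNorm'_eq {α : Type*} [Fintype α] (x : α → ℝ) :
    ∃ u, ∑ i, |x i - u| = centralNorm' x := by
  refine ⟨center (x ∘ (Fintype.equivFin α).symm), ?_⟩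
  rw [← Equiv.sum_comp (Fintype.equivFin α).symm]
  exact (centralNorm_eq _).symm

lemma weighted_sum {m : ℕ} (r : Fin m → ℚ) (hr : ∀ j, r j ≠ 0) (q : ℚ) (hq : 0 < q)
    (t : Fin m → ℤ) (ht : ∀ j, (t j : ℚ) = q / r j) (w : Fin m → ℝ) (u : ℝ) :
    ∑ p : (j : Fin m) × Fin (t j).natAbs, |(r p.1 : ℝ) * w p.1 - u| =
      (∑ j, |w j - u / r j|) * q := by
  rw [Fintype.sum_sigma, Finset.sum_mul]
  refine Finset.sum_congr rfl fun j _ => ?_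
  have hrj : (r j : ℝ) ≠ 0 := by exact_mod_cast hr j
  have hq' : (0 : ℝ) < q := by exact_mod_cast hq
  have e : ((t j).natAbs : ℝ) = q / |(r j : ℝ)| := by
    rw [Nat.cast_natAbs, Int.cast_abs]
    have : (t j : ℝ) = q / r j := by exact_mod_cast congrArg (fun z : ℚ => (z : ℝ)) (ht j)
    rw [this, abs_div, abs_of_pos hq']
  have e2 : (r j : ℝ) * w j - u = r j * (w j - u / r j) := by field_simp
  have : |(r j : ℝ)| ≠ 0 := abs_ne_zero.mpr hrj
  simp only [Finset.sum_const, Finset.card_univ, Fintype.card_fin, nsmul_eq_mul]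
  rw [e, e2, abs_mul]
  field_simp

lemma sub_isUnit {s : ℕ} (c : Fin (s+1) → ℝ) (hc : ∀ j, c j ≠ 0)
    (R : Matrix (Fin (s + 1)) (Fin s) ℝ) (hrank : R.rank = s)
    (hsum : ∀ k : Fin s, ∑ j : Fin (s + 1), c j * R j k = 0) :
    IsUnit (R.submatrix Fin.castSucc id) := by
  rw [← Matrix.mulVec_injective_iff_isUnit]
  have hinj : Function.Injective R.mulVecLin := by
    rw [← LinearMap.ker_eq_bot, ← Submodule.finrank_eq_zero]
    have := R.mulVecLin.finrank_range_add_finrank_ker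
    rw [Matrix.rank] at hrank
    simp only [Module.finrank_fin_fun] at this
    omega
  intro v w hvw
  apply hinj
  have h0 : ∀ j : Fin s, (R.mulVec v) j.castSucc = (R.mulVec w) j.castSucc := fun j => congrFun hvw j
  have hz : ∀ v : Fin s → ℝ, ∑ j, c j * (R.mulVec v) j = 0 := by
    intro v
    have : ∑ j, c j * (R.mulVec v) j = ∑ k, (∑ j, c j * R j k) * v k := by
      simp only [Matrix.mulVec, dotProduct, Finset.mul_sum, Finset.sum_mul]
      rw [Finset.sum_comm]
      simp only [mul_assoc]
    rw [this]; simp [hsum]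
  have hv := hz v
  have hw := hz w
  rw [Fin.sum_univ_castSucc] at hv hw
  simp only [h0] at hv
  ext j
  refine Fin.lastCases ?_ (fun j => h0 j) j
  exact mul_left_cancel₀ (hc (Fin.last s)) (by simp only [Matrix.mulVecLin_apply]; linarith)

lemma leftInv_iff {s : ℕ} (c : Fin (s+1) → ℝ) (hc : ∀ j, c j ≠ 0)
    (R : Matrix (Fin (s + 1)) (Fin s) ℝ) (hrank : R.rank = s)
    (hsum : ∀ k : Fin s, ∑ j : Fin (s + 1), c j * R j k = 0)
    (R' : Matrix (Fin s) (Fin (s + 1)) ℝ) :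
    R' * R = 1 ↔ ∃ u : Fin s → ℝ, ∀ i j, R' i j =
      (Fin.snoc ((R.submatrix Fin.castSucc id)⁻¹ i) (0 : ℝ) : Fin (s + 1) → ℝ) j - u i * c j := by
  have hA := sub_isUnit c hc R hrank hsum
  set A := R.submatrix Fin.castSucc id with hAdef
  have hdet : IsUnit A.det := (Matrix.isUnit_iff_isUnit_det A).mp hA
  have hW : ∀ i k, ∑ j, (Fin.snoc (A⁻¹ i) (0 : ℝ) : Fin (s + 1) → ℝ) j * R j k
      = (1 : Matrix (Fin s) (Fin s) ℝ) i k := by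
    intro i k
    rw [Fin.sum_univ_castSucc, ← Matrix.nonsing_inv_mul A hdet]
    simp [Matrix.mul_apply, hAdef]
  constructor
  · intro h
    refine ⟨fun i => - (R' i (Fin.last s) / c (Fin.last s)), fun i => ?_⟩
    set u := - (R' i (Fin.last s) / c (Fin.last s)) with hu
    have hlast : R' i (Fin.last s) + u * c (Fin.last s) = 0 := by
      rw [hu]; field_simp [hc (Fin.last s)]; ring
    have hv : Matrix.vecMul (fun j : Fin s => R' i j.castSucc + u * c j.castSucc) A
        = Matrix.vecMul (A⁻¹ i) A := by
      ext k
      have h1 : ∑ j, (R' i j + u * c j) * R j k = (1 : Matrix (Fin s) (Fin s) ℝ) i k := by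
        simp only [add_mul, Finset.sum_add_distrib, mul_assoc, ← Finset.mul_sum]
        rw [hsum, ← h, Matrix.mul_apply]; ring
      have h2 := hW i k
      rw [← h1, Fin.sum_univ_castSucc, Fin.sum_univ_castSucc, hlast] at h2
      simp only [Fin.snoc_castSucc, Fin.snoc_last, zero_mul, add_zero] at h2
      exact h2.symm
    have hv2 := Matrix.vecMul_injective_of_isUnit hA hv
    intro j
    refine Fin.lastCases ?_ (fun j => ?_) j
    · simp only [Fin.snoc_last]; linarith
    · have := congrFun hv2 j
      simp only [Fin.snoc_castSucc]
      linarith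
  · rintro ⟨u, hu⟩
    ext i k
    rw [Matrix.mul_apply, ← hW i k]
    simp only [hu, sub_mul, Finset.sum_sub_distrib, mul_assoc, ← Finset.mul_sum]
    rw [hsum]; ring


/-- Proposition 4: with rescaled valuations (weights `r_j`), `q > 0` rational such that
`t_j = q / r_j` are nonzero integers, and `w'ᵢ` the vector consisting of `|t_j|` copies
of `r_j · w_{i,j}` for each `j` (with `w_{i,s} = 0`), the minimum of `‖R'‖` over all left
inverses `R'` of `R` exists and equals `(max_{1 ≤ i ≤ s-1} |w'ᵢ|_C) / q`. -/
theorem stmt13 (s : ℕ) (hs : 1 ≤ s) (r : Fin (s + 1) → ℚ) (hr : ∀ j, r j ≠ 0)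
    (R : Matrix (Fin (s + 1)) (Fin s) ℝ) (hrank : R.rank = s)
    (hsum : ∀ k : Fin s, ∑ j : Fin (s + 1), ((r j : ℝ))⁻¹ * R j k = 0)
    (q : ℚ) (hq : 0 < q) (t : Fin (s + 1) → ℤ) (ht0 : ∀ j, t j ≠ 0)
    (ht : ∀ j, (t j : ℚ) = q / r j) :
    IsLeast (rowNorm '' {R' : Matrix (Fin s) (Fin (s + 1)) ℝ | R' * R = 1})
      ((⨆ i : Fin s,
          centralNorm' (fun p : (j : Fin (s + 1)) × Fin (t j).natAbs =>
            (r p.1 : ℝ) *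
              (Fin.snoc ((R.submatrix Fin.castSucc id)⁻¹ i) (0 : ℝ) : Fin (s + 1) → ℝ) p.1)) / (q : ℝ)) := by
  have hc : ∀ j, ((r j : ℝ))⁻¹ ≠ 0 := fun j => inv_ne_zero (by exact_mod_cast hr j)
  have hq' : (0 : ℝ) < q := by exact_mod_cast hq
  have hiff := leftInv_iff (fun j => ((r j : ℝ))⁻¹) hc R hrank hsum
  haveI : Nonempty (Fin s) := ⟨⟨0, hs⟩⟩
  generalize (R.submatrix Fin.castSucc id)⁻¹ = B at hiff ⊢
  have hws := fun i => weighted_sum r hr q hq t ht (Fin.snoc (B i) (0 : ℝ) : Fin (s + 1) → ℝ)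
  constructor
  · choose u hu using fun i : Fin s => centralNorm'_eq
      (fun p : (j : Fin (s + 1)) × Fin (t j).natAbs =>
            (r p.1 : ℝ) * (Fin.snoc (B i) (0 : ℝ) : Fin (s + 1) → ℝ) p.1)
    refine ⟨Matrix.of fun i j => (Fin.snoc (B i) (0 : ℝ) : Fin (s + 1) → ℝ) j - u i * ((r j : ℝ))⁻¹,
      (hiff _).2 ⟨u, fun i j => rfl⟩, ?_⟩
    rw [eq_div_iff hq'.ne', rowNorm, Real.iSup_mul_of_nonneg hq'.le]
    refine iSup_congr fun i => ?_
    rw [← hu i, hws i (u i)]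
    simp only [Matrix.of_apply, div_eq_mul_inv]
  · rintro _ ⟨R', hR', rfl⟩
    obtain ⟨u, hu⟩ := (hiff R').1 hR'
    rw [div_le_iff₀ hq', rowNorm, Real.iSup_mul_of_nonneg hq'.le]
    refine ciSup_mono (Set.finite_range _).bddAbove fun i => ?_
    refine (centralNorm'_le _ (u i)).trans (le_of_eq ?_)
    rw [hws i (u i)]
    simp only [hu, div_eq_mul_inv]
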